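/- arXiv:2203.13045 — 2 statements merged into one kernel-verified Lean document; each statement's English description precedes it below -/
import Mathlib

section
/- Let (u,v) be a smooth solution of the Pavlov–Mikhalev system on ℝ³. Then the pair (φ^u, φ^v) with φ^u = y·u_x − 2x and φ^v = y·v_x satisfies the linearized system, i.e., it is a symmetry generating function (the symmetry φ₁). -/
noncomputable section

/-- Partial derivative with respect to the first coordinate `t`. -/
def Dt (f : ℝ → ℝ → ℝ → ℝ) : ℝ → ℝ → ℝ → ℝ := fun t x y => deriv (fun s => f s x y) t

/-- Partial derivative with respect to the second coordinate `x`. -/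
def Dx (f : ℝ → ℝ → ℝ → ℝ) : ℝ → ℝ → ℝ → ℝ := fun t x y => deriv (fun s => f t s y) x

/-- Partial derivative with respect to the third coordinate `y`. -/
def Dy (f : ℝ → ℝ → ℝ → ℝ) : ℝ → ℝ → ℝ → ℝ := fun t x y => deriv (fun s => f t x s) y

/-- `f` is a smooth function on `ℝ³` (given in curried form, coordinates `(t, x, y)`). -/
def Smooth3 (f : ℝ → ℝ → ℝ → ℝ) : Prop :=
  ContDiff ℝ (⊤ : ℕ∞) (fun p : ℝ × ℝ × ℝ => f p.1 p.2.1 p.2.2)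

/-- The Pavlov–Mikhalev equation `u_yy = u_xt − u_x·u_xy + u_y·u_xx`. -/
def PMu (u : ℝ → ℝ → ℝ → ℝ) : Prop :=
  ∀ t x y : ℝ, Dy (Dy u) t x y =
    Dt (Dx u) t x y - Dx u t x y * Dy (Dx u) t x y + Dy u t x y * Dx (Dx u) t x y

/-- The second equation of the two-component Pavlov–Mikhalev system:
`v_yy = v_xt − u_x·v_xy − 2·v_y·u_xx + 2·v_x·u_xy + u_y·v_xx`. -/
def PMv (u v : ℝ → ℝ → ℝ → ℝ) : Prop :=
  ∀ t x y : ℝ, Dy (Dy v) t x y =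
    Dt (Dx v) t x y - Dx u t x y * Dy (Dx v) t x y
      - 2 * Dy v t x y * Dx (Dx u) t x y + 2 * Dx v t x y * Dy (Dx u) t x y
      + Dy u t x y * Dx (Dx v) t x y

/-- First equation of the linearized system applied to `A = φ^u`:
`φ^u_yy = φ^u_xt + u_xx·φ^u_y + u_y·φ^u_xx − u_x·φ^u_xy − u_xy·φ^u_x`. -/
def LinU (u A : ℝ → ℝ → ℝ → ℝ) : Prop :=
  ∀ t x y : ℝ, Dy (Dy A) t x y =
    Dt (Dx A) t x y + Dx (Dx u) t x y * Dy A t x y + Dy u t x y * Dx (Dx A) t x y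
      - Dx u t x y * Dy (Dx A) t x y - Dy (Dx u) t x y * Dx A t x y

/-- Second equation of the linearized system applied to `(A, B) = (φ^u, φ^v)`. -/
def LinV (u v A B : ℝ → ℝ → ℝ → ℝ) : Prop :=
  ∀ t x y : ℝ, Dy (Dy B) t x y =
    2 * Dx v t x y * Dy (Dx A) t x y - Dy (Dx v) t x y * Dx A t x y
      + Dx (Dx v) t x y * Dy A t x y - 2 * Dy v t x y * Dx (Dx A) t x y
      + Dt (Dx B) t x y + 2 * Dy (Dx u) t x y * Dx B t x y
      - 2 * Dx (Dx u) t x y * Dy B t x y + Dy u t x y * Dx (Dx B) t x y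
      - Dx u t x y * Dy (Dx B) t x y

/-- `(A,B)` is a symmetry generating function of the Pavlov–Mikhalev system over `(u,v)`. -/
def IsSymmetry (u v A B : ℝ → ℝ → ℝ → ℝ) : Prop := LinU u A ∧ LinV u v A B

/-- First equation of the tangent system over a solution `(u,v)`:
`p_yy = u_y·p_xx − u_xy·p_x − u_x·p_xy + u_xx·p_y + p_xt`. -/
def TanP (u p : ℝ → ℝ → ℝ → ℝ) : Prop :=
  ∀ t x y : ℝ, Dy (Dy p) t x y =
    Dy u t x y * Dx (Dx p) t x y - Dy (Dx u) t x y * Dx p t x y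
      - Dx u t x y * Dy (Dx p) t x y + Dx (Dx u) t x y * Dy p t x y + Dt (Dx p) t x y

/-- Second equation of the tangent system over a solution `(u,v)`:
`q_yy = 2·v_x·p_xy + v_xx·p_y − v_xy·p_x − 2·v_y·p_xx + 2·u_xy·q_x + u_y·q_xx
  − u_x·q_xy − 2·u_xx·q_y + q_xt`. -/
def TanQ (u v p q : ℝ → ℝ → ℝ → ℝ) : Prop :=
  ∀ t x y : ℝ, Dy (Dy q) t x y =
    2 * Dx v t x y * Dy (Dx p) t x y + Dx (Dx v) t x y * Dy p t x y
      - Dy (Dx v) t x y * Dx p t x y - 2 * Dy v t x y * Dx (Dx p) t x y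
      + 2 * Dy (Dx u) t x y * Dx q t x y + Dy u t x y * Dx (Dx q) t x y
      - Dx u t x y * Dy (Dx q) t x y - 2 * Dx (Dx u) t x y * Dy q t x y
      + Dt (Dx q) t x y


/-- Directional derivatives of a smooth function of three variables commute. -/
theorem fderiv_fderiv_apply_comm {F : ℝ × ℝ × ℝ → ℝ} (hF : ContDiff ℝ (⊤ : ℕ∞) F)
    (p a b : ℝ × ℝ × ℝ) :
    fderiv ℝ (fun q => fderiv ℝ F q a) p b = fderiv ℝ (fun q => fderiv ℝ F q b) p a := by
  have hd : DifferentiableAt ℝ (fderiv ℝ F) p :=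
    (hF.fderiv_right (m := 1) (by norm_cast)).differentiable one_ne_zero p
  have hs : IsSymmSndFDerivAt ℝ F p :=
    hF.contDiffAt.isSymmSndFDerivAt (by
      rw [minSmoothness_of_isRCLikeNormedField]
      exact WithTop.coe_le_coe.2 (le_top : (2 : ℕ∞) ≤ ⊤))
  rw [fderiv_clm_apply hd (differentiableAt_const a),
    fderiv_clm_apply hd (differentiableAt_const b)]
  simpa using hs.eq b a

namespace Smooth3

variable {f : ℝ → ℝ → ℝ → ℝ}

theorem hasFDerivAt (hf : Smooth3 f) (p : ℝ × ℝ × ℝ) :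
    HasFDerivAt (fun p : ℝ × ℝ × ℝ => f p.1 p.2.1 p.2.2)
      (fderiv ℝ (fun p : ℝ × ℝ × ℝ => f p.1 p.2.1 p.2.2) p) p :=
  (hf.differentiable (by simp) p).hasFDerivAt

theorem hasDerivAt_fst (hf : Smooth3 f) (t x y : ℝ) :
    HasDerivAt (fun s => f s x y)
      (fderiv ℝ (fun p : ℝ × ℝ × ℝ => f p.1 p.2.1 p.2.2) (t, x, y) (1, 0, 0)) t :=
  HasFDerivAt.comp_hasDerivAt (f := fun s : ℝ => (s, x, y)) t (hf.hasFDerivAt (t, x, y))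
    ((hasDerivAt_id t).prodMk ((hasDerivAt_const t x).prodMk (hasDerivAt_const t y)))

theorem hasDerivAt_snd (hf : Smooth3 f) (t x y : ℝ) :
    HasDerivAt (fun s => f t s y)
      (fderiv ℝ (fun p : ℝ × ℝ × ℝ => f p.1 p.2.1 p.2.2) (t, x, y) (0, 1, 0)) x :=
  HasFDerivAt.comp_hasDerivAt (f := fun s : ℝ => (t, s, y)) x (hf.hasFDerivAt (t, x, y))
    ((hasDerivAt_const x t).prodMk ((hasDerivAt_id x).prodMk (hasDerivAt_const x y)))

theorem hasDerivAt_thd (hf : Smooth3 f) (t x y : ℝ) :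
    HasDerivAt (fun s => f t x s)
      (fderiv ℝ (fun p : ℝ × ℝ × ℝ => f p.1 p.2.1 p.2.2) (t, x, y) (0, 0, 1)) y :=
  HasFDerivAt.comp_hasDerivAt (f := fun s : ℝ => (t, x, s)) y (hf.hasFDerivAt (t, x, y))
    ((hasDerivAt_const y t).prodMk ((hasDerivAt_const y x).prodMk (hasDerivAt_id y)))

theorem Dt_eq (hf : Smooth3 f) : Dt f = fun t x y =>
    fderiv ℝ (fun p : ℝ × ℝ × ℝ => f p.1 p.2.1 p.2.2) (t, x, y) (1, 0, 0) := by
  funext t x y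
  exact (hf.hasDerivAt_fst t x y).deriv

theorem Dx_eq (hf : Smooth3 f) : Dx f = fun t x y =>
    fderiv ℝ (fun p : ℝ × ℝ × ℝ => f p.1 p.2.1 p.2.2) (t, x, y) (0, 1, 0) := by
  funext t x y
  exact (hf.hasDerivAt_snd t x y).deriv

theorem Dy_eq (hf : Smooth3 f) : Dy f = fun t x y =>
    fderiv ℝ (fun p : ℝ × ℝ × ℝ => f p.1 p.2.1 p.2.2) (t, x, y) (0, 0, 1) := by
  funext t x y
  exact (hf.hasDerivAt_thd t x y).deriv

theorem fderiv_apply (hf : Smooth3 f) (a : ℝ × ℝ × ℝ) : Smooth3 fun t x y =>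
    fderiv ℝ (fun p : ℝ × ℝ × ℝ => f p.1 p.2.1 p.2.2) (t, x, y) a :=
  (hf.fderiv_right (m := (⊤ : ℕ∞)) (by norm_cast)).clm_apply contDiff_const

theorem smooth_Dt (hf : Smooth3 f) : Smooth3 (Dt f) := hf.Dt_eq ▸ hf.fderiv_apply _

theorem smooth_Dx (hf : Smooth3 f) : Smooth3 (Dx f) := hf.Dx_eq ▸ hf.fderiv_apply _

theorem smooth_Dy (hf : Smooth3 f) : Smooth3 (Dy f) := hf.Dy_eq ▸ hf.fderiv_apply _

theorem hasDerivAt_Dt (hf : Smooth3 f) (t x y : ℝ) :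
    HasDerivAt (fun s => f s x y) (Dt f t x y) t :=
  (hf.hasDerivAt_fst t x y).differentiableAt.hasDerivAt

theorem hasDerivAt_Dx (hf : Smooth3 f) (t x y : ℝ) :
    HasDerivAt (fun s => f t s y) (Dx f t x y) x :=
  (hf.hasDerivAt_snd t x y).differentiableAt.hasDerivAt

theorem hasDerivAt_Dy (hf : Smooth3 f) (t x y : ℝ) :
    HasDerivAt (fun s => f t x s) (Dy f t x y) y :=
  (hf.hasDerivAt_thd t x y).differentiableAt.hasDerivAt

theorem Dx_Dt_comm (hf : Smooth3 f) : Dx (Dt f) = Dt (Dx f) := by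
  rw [hf.smooth_Dt.Dx_eq, hf.smooth_Dx.Dt_eq, hf.Dx_eq, hf.Dt_eq]
  funext t x y
  exact fderiv_fderiv_apply_comm hf _ _ _

theorem Dx_Dy_comm (hf : Smooth3 f) : Dx (Dy f) = Dy (Dx f) := by
  rw [hf.smooth_Dy.Dx_eq, hf.smooth_Dx.Dy_eq, hf.Dx_eq, hf.Dy_eq]
  funext t x y
  exact fderiv_fderiv_apply_comm hf _ _ _

theorem Dt_thd_mul_sub (hf : Smooth3 f) (c : ℝ) :
    Dt (fun t x y => y * f t x y - c) = fun t x y => y * Dt f t x y := by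
  funext t x y
  exact (((hf.hasDerivAt_Dt t x y).const_mul y).sub_const c).deriv

theorem Dx_thd_mul_sub (hf : Smooth3 f) (c : ℝ) :
    Dx (fun t x y => y * f t x y - c * x) = fun t x y => y * Dx f t x y - c := by
  funext t x y
  refine (((hf.hasDerivAt_Dx t x y).const_mul y).sub
    ((hasDerivAt_id x).const_mul c)).deriv.trans ?_
  ring

theorem Dy_thd_mul_sub (hf : Smooth3 f) (g : ℝ → ℝ → ℝ) :
    Dy (fun t x y => y * f t x y - g t x) = fun t x y => f t x y + y * Dy f t x y := by
  funext t x y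
  refine (((hasDerivAt_id y).mul (hf.hasDerivAt_Dy t x y)).sub_const (g t x)).deriv.trans ?_
  simp only [id, one_mul]

theorem Dx_thd_mul_sub_const (hf : Smooth3 f) (c : ℝ) :
    Dx (fun t x y => y * f t x y - c) = fun t x y => y * Dx f t x y := by
  funext t x y
  exact (((hf.hasDerivAt_Dx t x y).const_mul y).sub_const c).deriv

theorem Dy_Dy_thd_mul_sub (hf : Smooth3 f) (g : ℝ → ℝ → ℝ) :
    Dy (Dy fun t x y => y * f t x y - g t x) =
      fun t x y => 2 * Dy f t x y + y * Dy (Dy f) t x y := by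
  rw [hf.Dy_thd_mul_sub]
  funext t x y
  refine ((hf.hasDerivAt_Dy t x y).add
    ((hasDerivAt_id y).mul (hf.smooth_Dy.hasDerivAt_Dy t x y))).deriv.trans ?_
  simp only [id]
  ring

end Smooth3

/-- The `x`-derivative of the Pavlov–Mikhalev equation for `u`. -/
theorem PMu.deriv_x {u : ℝ → ℝ → ℝ → ℝ} (h : PMu u) (hu : Smooth3 u) (t x y : ℝ) :
    Dy (Dy (Dx u)) t x y =
      Dt (Dx (Dx u)) t x y - Dx u t x y * Dy (Dx (Dx u)) t x y
        + Dy u t x y * Dx (Dx (Dx u)) t x y := by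
  have hux := hu.smooth_Dx
  have hd := (((hux.smooth_Dt.hasDerivAt_Dx t x y).sub
    ((hux.hasDerivAt_Dx t x y).mul (hux.smooth_Dy.hasDerivAt_Dx t x y))).add
    ((hu.smooth_Dy.hasDerivAt_Dx t x y).mul (hux.smooth_Dx.hasDerivAt_Dx t x y))).deriv
  have hl : Dx (Dy (Dy u)) t x y = _ :=
    (congrArg (fun g : ℝ → ℝ => deriv g x) (funext fun s => h t s y)).trans hd
  rw [hu.smooth_Dy.Dx_Dy_comm, hu.Dx_Dy_comm, hux.Dx_Dt_comm, hux.Dx_Dy_comm] at hl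
  linear_combination hl

/-- The `x`-derivative of the Pavlov–Mikhalev equation for `v`. -/
theorem PMv.deriv_x {u v : ℝ → ℝ → ℝ → ℝ} (h : PMv u v) (hu : Smooth3 u) (hv : Smooth3 v)
    (t x y : ℝ) :
    Dy (Dy (Dx v)) t x y =
      Dt (Dx (Dx v)) t x y - Dx u t x y * Dy (Dx (Dx v)) t x y
        - 3 * Dy (Dx v) t x y * Dx (Dx u) t x y - 2 * Dy v t x y * Dx (Dx (Dx u)) t x y
        + 2 * Dx v t x y * Dy (Dx (Dx u)) t x y + 3 * Dx (Dx v) t x y * Dy (Dx u) t x y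
        + Dy u t x y * Dx (Dx (Dx v)) t x y := by
  have hux := hu.smooth_Dx
  have hvx := hv.smooth_Dx
  have hd := (((((hvx.smooth_Dt.hasDerivAt_Dx t x y).sub
    ((hux.hasDerivAt_Dx t x y).mul (hvx.smooth_Dy.hasDerivAt_Dx t x y))).sub
    (((hv.smooth_Dy.hasDerivAt_Dx t x y).const_mul 2).mul
      (hux.smooth_Dx.hasDerivAt_Dx t x y))).add
    (((hvx.hasDerivAt_Dx t x y).const_mul 2).mul (hux.smooth_Dy.hasDerivAt_Dx t x y))).add
    ((hu.smooth_Dy.hasDerivAt_Dx t x y).mul (hvx.smooth_Dx.hasDerivAt_Dx t x y))).deriv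
  have hl : Dx (Dy (Dy v)) t x y = _ :=
    (congrArg (fun g : ℝ → ℝ => deriv g x) (funext fun s => h t s y)).trans hd
  rw [hv.smooth_Dy.Dx_Dy_comm, hv.Dx_Dy_comm, hvx.Dx_Dt_comm, hvx.Dx_Dy_comm,
    hux.Dx_Dy_comm, hu.Dx_Dy_comm] at hl
  linear_combination hl

theorem phi1_is_symmetry (u v : ℝ → ℝ → ℝ → ℝ) (hu : Smooth3 u) (hv : Smooth3 v)
    (hPMu : PMu u) (hPMv : PMv u v) :
    IsSymmetry u v
      (fun t x y => y * Dx u t x y - 2 * x)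
      (fun t x y => y * Dx v t x y) := by
  have hux := hu.smooth_Dx
  have hvx := hv.smooth_Dx
  have hB : (fun t x y => y * Dx v t x y) = fun t x y => y * Dx v t x y - 0 * x := by
    simp
  rw [hB]
  constructor
  · intro t x y
    rw [hux.Dy_Dy_thd_mul_sub fun _ x => 2 * x, hux.Dy_thd_mul_sub fun _ x => 2 * x,
      hux.Dx_thd_mul_sub, hux.smooth_Dx.Dt_thd_mul_sub, hux.smooth_Dx.Dx_thd_mul_sub_const,
      hux.smooth_Dx.Dy_thd_mul_sub fun _ _ => 2]
    linear_combination y * hPMu.deriv_x hu t x y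
  · intro t x y
    rw [hvx.Dy_Dy_thd_mul_sub fun _ x => 0 * x, hvx.Dy_thd_mul_sub fun _ x => 0 * x,
      hux.Dy_thd_mul_sub fun _ x => 2 * x,
      hux.Dx_thd_mul_sub, hux.smooth_Dx.Dx_thd_mul_sub_const,
      hux.smooth_Dx.Dy_thd_mul_sub fun _ _ => 2,
      hvx.Dx_thd_mul_sub, hvx.smooth_Dx.Dt_thd_mul_sub, hvx.smooth_Dx.Dx_thd_mul_sub_const,
      hvx.smooth_Dx.Dy_thd_mul_sub fun _ _ => 0]
    linear_combination y * hPMv.deriv_x hu hv t x y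
end
end

section
/- (Conservation law ω₂ of the tangent equation.) Let (u,v) be a smooth solution of the Pavlov–Mikhalev system on ℝ³ and let (p,q) be a smooth solution of the tangent system. Set X₂ = q_y − v_x·p_x − u_x·q_x and Y₂ = q_t − 2·v_y·p_x + v_x·p_y + u_y·q_x − 2·u_x·q_y. Then ∂_y(X₂) = ∂_x(Y₂) at every point of ℝ³. -/
noncomputable section

/-- Along a curve with constant velocity `w`, a smooth function of three variables has as derivative
its directional derivative in the direction `w`. -/
theorem Smooth3.hasDerivAt_comp {f : ℝ → ℝ → ℝ → ℝ} (hf : Smooth3 f) {c : ℝ → ℝ × ℝ × ℝ}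
    {w : ℝ × ℝ × ℝ} {s : ℝ} (hc : HasDerivAt c w s) :
    HasDerivAt (fun r => f (c r).1 (c r).2.1 (c r).2.2)
      (fderiv ℝ (fun p : ℝ × ℝ × ℝ => f p.1 p.2.1 p.2.2) (c s) w) s :=
  HasFDerivAt.comp_hasDerivAt s
    (ContDiff.differentiable hf (by simp) (c s)).hasFDerivAt hc

theorem hasDerivAt_curve_fst (t x y : ℝ) :
    HasDerivAt (fun s : ℝ => (s, x, y)) ((1, 0, 0) : ℝ × ℝ × ℝ) t :=
  (hasDerivAt_id t).prodMk ((hasDerivAt_const t x).prodMk (hasDerivAt_const t y))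

theorem hasDerivAt_curve_snd (t x y : ℝ) :
    HasDerivAt (fun s : ℝ => (t, s, y)) ((0, 1, 0) : ℝ × ℝ × ℝ) x :=
  (hasDerivAt_const x t).prodMk ((hasDerivAt_id x).prodMk (hasDerivAt_const x y))

theorem hasDerivAt_curve_trd (t x y : ℝ) :
    HasDerivAt (fun s : ℝ => (t, x, s)) ((0, 0, 1) : ℝ × ℝ × ℝ) y :=
  (hasDerivAt_const y t).prodMk ((hasDerivAt_const y x).prodMk (hasDerivAt_id y))

theorem Smooth3.Dt_eq_s13 {f : ℝ → ℝ → ℝ → ℝ} (hf : Smooth3 f) (t x y : ℝ) :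
    Dt f t x y = fderiv ℝ (fun p : ℝ × ℝ × ℝ => f p.1 p.2.1 p.2.2) (t, x, y) (1, 0, 0) :=
  (hf.hasDerivAt_comp (hasDerivAt_curve_fst t x y)).deriv

theorem Smooth3.Dx_eq_s13 {f : ℝ → ℝ → ℝ → ℝ} (hf : Smooth3 f) (t x y : ℝ) :
    Dx f t x y = fderiv ℝ (fun p : ℝ × ℝ × ℝ => f p.1 p.2.1 p.2.2) (t, x, y) (0, 1, 0) :=
  (hf.hasDerivAt_comp (hasDerivAt_curve_snd t x y)).deriv

theorem Smooth3.Dy_eq_s13 {f : ℝ → ℝ → ℝ → ℝ} (hf : Smooth3 f) (t x y : ℝ) :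
    Dy f t x y = fderiv ℝ (fun p : ℝ × ℝ × ℝ => f p.1 p.2.1 p.2.2) (t, x, y) (0, 0, 1) :=
  (hf.hasDerivAt_comp (hasDerivAt_curve_trd t x y)).deriv

theorem Smooth3.fderiv_apply_s13 {f : ℝ → ℝ → ℝ → ℝ} (hf : Smooth3 f) (w : ℝ × ℝ × ℝ) :
    Smooth3 fun t x y => fderiv ℝ (fun p : ℝ × ℝ × ℝ => f p.1 p.2.1 p.2.2) (t, x, y) w :=
  (ContDiff.fderiv_right (m := (⊤ : ℕ∞)) hf (by simp)).clm_apply contDiff_const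

theorem Smooth3.Dt {f : ℝ → ℝ → ℝ → ℝ} (hf : Smooth3 f) : Smooth3 (Dt f) := by
  rw [show _root_.Dt f = _ from funext fun t => funext fun x => funext fun y => hf.Dt_eq_s13 t x y]
  exact hf.fderiv_apply_s13 _

theorem Smooth3.Dx {f : ℝ → ℝ → ℝ → ℝ} (hf : Smooth3 f) : Smooth3 (Dx f) := by
  rw [show _root_.Dx f = _ from funext fun t => funext fun x => funext fun y => hf.Dx_eq_s13 t x y]
  exact hf.fderiv_apply_s13 _

theorem Smooth3.Dy {f : ℝ → ℝ → ℝ → ℝ} (hf : Smooth3 f) : Smooth3 (Dy f) := by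
  rw [show _root_.Dy f = _ from funext fun t => funext fun x => funext fun y => hf.Dy_eq_s13 t x y]
  exact hf.fderiv_apply_s13 _

theorem Smooth3.hasDerivAt_Dx_s13 {f : ℝ → ℝ → ℝ → ℝ} (hf : Smooth3 f) (t x y : ℝ) :
    HasDerivAt (fun s => f t s y) (_root_.Dx f t x y) x :=
  (hf.hasDerivAt_comp (hasDerivAt_curve_snd t x y)).differentiableAt.hasDerivAt

theorem Smooth3.hasDerivAt_Dy_s13 {f : ℝ → ℝ → ℝ → ℝ} (hf : Smooth3 f) (t x y : ℝ) :
    HasDerivAt (fun s => f t x s) (_root_.Dy f t x y) y :=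
  (hf.hasDerivAt_comp (hasDerivAt_curve_trd t x y)).differentiableAt.hasDerivAt

/-- Directional derivatives of a smooth function of three variables commute. -/
theorem Smooth3.fderiv_fderiv_comm {f : ℝ → ℝ → ℝ → ℝ} (hf : Smooth3 f) (z v w : ℝ × ℝ × ℝ) :
    fderiv ℝ (fun a => fderiv ℝ (fun p : ℝ × ℝ × ℝ => f p.1 p.2.1 p.2.2) a v) z w =
      fderiv ℝ (fun a => fderiv ℝ (fun p : ℝ × ℝ × ℝ => f p.1 p.2.1 p.2.2) a w) z v := by
  have hd : DifferentiableAt ℝ (fderiv ℝ (fun p : ℝ × ℝ × ℝ => f p.1 p.2.1 p.2.2)) z :=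
    (ContDiff.fderiv_right (m := (⊤ : ℕ∞)) hf (by simp)).differentiable (by simp) z
  have hs : IsSymmSndFDerivAt ℝ (fun p : ℝ × ℝ × ℝ => f p.1 p.2.1 p.2.2) z :=
    (ContDiff.contDiffAt hf).isSymmSndFDerivAt
      (by simpa using WithTop.coe_le_coe.2 (le_top : (2 : ℕ∞) ≤ ⊤))
  rw [fderiv_clm_apply hd (differentiableAt_const v),
    fderiv_clm_apply hd (differentiableAt_const w)]
  simpa using hs w v

theorem Smooth3.Dx_Dt {f : ℝ → ℝ → ℝ → ℝ} (hf : Smooth3 f) :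
    _root_.Dx (_root_.Dt f) = _root_.Dt (_root_.Dx f) := by
  funext t x y
  rw [hf.Dt.Dx_eq_s13, hf.Dx.Dt_eq_s13]
  simp only [hf.Dt_eq_s13, hf.Dx_eq_s13]
  exact hf.fderiv_fderiv_comm _ _ _

theorem Smooth3.Dx_Dy {f : ℝ → ℝ → ℝ → ℝ} (hf : Smooth3 f) :
    _root_.Dx (_root_.Dy f) = _root_.Dy (_root_.Dx f) := by
  funext t x y
  rw [hf.Dy.Dx_eq_s13, hf.Dx.Dy_eq_s13]
  simp only [hf.Dy_eq_s13, hf.Dx_eq_s13]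
  exact hf.fderiv_fderiv_comm _ _ _

theorem conservation_law_omega2 (u v p q : ℝ → ℝ → ℝ → ℝ)
    (hu : Smooth3 u) (hv : Smooth3 v) (hp : Smooth3 p) (hq : Smooth3 q)
    (hPMu : PMu u) (hPMv : PMv u v) (hTanP : TanP u p) (hTanQ : TanQ u v p q)
    (X₂ Y₂ : ℝ → ℝ → ℝ → ℝ)
    (hX : X₂ = fun t x y => Dy q t x y - Dx v t x y * Dx p t x y - Dx u t x y * Dx q t x y)
    (hY : Y₂ = fun t x y => Dt q t x y - 2 * Dy v t x y * Dx p t x y + Dx v t x y * Dy p t x y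
      + Dy u t x y * Dx q t x y - 2 * Dx u t x y * Dy q t x y) :
    ∀ t x y : ℝ, Dy X₂ t x y = Dx Y₂ t x y := by
  intro t x y
  have hXy := (((hq.Dy.hasDerivAt_Dy_s13 t x y).fun_sub
    ((hv.Dx.hasDerivAt_Dy_s13 t x y).fun_mul (hp.Dx.hasDerivAt_Dy_s13 t x y))).fun_sub
    ((hu.Dx.hasDerivAt_Dy_s13 t x y).fun_mul (hq.Dx.hasDerivAt_Dy_s13 t x y))).deriv
  have hYx := (((((hq.Dt.hasDerivAt_Dx_s13 t x y).fun_sub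
    (((hv.Dy.hasDerivAt_Dx_s13 t x y).const_mul 2).fun_mul (hp.Dx.hasDerivAt_Dx_s13 t x y))).fun_add
    ((hv.Dx.hasDerivAt_Dx_s13 t x y).fun_mul (hp.Dy.hasDerivAt_Dx_s13 t x y))).fun_add
    ((hu.Dy.hasDerivAt_Dx_s13 t x y).fun_mul (hq.Dx.hasDerivAt_Dx_s13 t x y))).fun_sub
    (((hu.Dx.hasDerivAt_Dx_s13 t x y).const_mul 2).fun_mul (hq.Dy.hasDerivAt_Dx_s13 t x y))).deriv
  subst hX hY
  refine hXy.trans (Eq.trans ?_ hYx.symm)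
  rw [hTanQ t x y, hq.Dx_Dt, hv.Dx_Dy, hp.Dx_Dy, hu.Dx_Dy, hq.Dx_Dy]
  ring
end
end
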